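/- arXiv:2007.05901 — 2 statements merged into one kernel-verified Lean document; each statement's English description precedes it below -/
import Mathlib

section
/- Let m ≥ 3, n = (q^m−1)/(q−1), and let T be any set of t pairwise distinct coordinate positions of the Hamming code H_{(q,m)} such that t < ((q−1)/(q+1))·n if m is even, and t < ((q−1)/(q+1))·(n−q^2) if m is odd. Then the minimum distance of the shortened code (H_{(q,m)})_T is exactly 3. -/
open Finset

section Defs

variable {F : Type} [Field F]

/-- The dual of a linear code `C ⊆ F^ι` w.r.t. the standard inner product. -/
def dualCode {ι : Type} [Fintype ι] (C : Submodule F (ι → F)) :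
    Submodule F (ι → F) where
  carrier := {x | ∀ c ∈ C, ∑ i, x i * c i = 0}
  add_mem' := by
    intro a b ha hb c hc
    simp only [Set.mem_setOf_eq] at ha hb ⊢
    simp only [Pi.add_apply, add_mul, Finset.sum_add_distrib, ha c hc, hb c hc, add_zero]
  zero_mem' := by
    intro c hc
    simp
  smul_mem' := by
    intro r a ha c hc
    simp only [Set.mem_setOf_eq] at ha ⊢
    simp only [Pi.smul_apply, smul_eq_mul, mul_assoc, ← Finset.mul_sum, ha c hc, mul_zero]

/-- The subcode of codewords vanishing on every coordinate in `T`. -/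
def zeroOn {ι : Type} (T : Finset ι) : Submodule F (ι → F) where
  carrier := {x | ∀ i ∈ T, x i = 0}
  add_mem' := by
    intro a b ha hb i hi
    simp only [Set.mem_setOf_eq] at ha hb
    simp [Pi.add_apply, ha i hi, hb i hi]
  zero_mem' := by intro i _; simp
  smul_mem' := by
    intro r a ha i hi
    simp only [Set.mem_setOf_eq] at ha
    simp [Pi.smul_apply, ha i hi]

/-- Deleting the coordinates in `T`. -/
def restrictTo {ι : Type} (T : Finset ι) : (ι → F) →ₗ[F] ({i : ι // i ∉ T} → F) :=
  LinearMap.funLeft F F Subtype.val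

/-- The punctured code `C^T`: delete the coordinates in `T` from every codeword. -/
def puncturedCode {ι : Type} (C : Submodule F (ι → F)) (T : Finset ι) :
    Submodule F ({i : ι // i ∉ T} → F) :=
  C.map (restrictTo T)

/-- The shortened code `C_T`: take the codewords vanishing on `T`, then delete `T`. -/
def shortenedCode {ι : Type} (C : Submodule F (ι → F)) (T : Finset ι) :
    Submodule F ({i : ι // i ∉ T} → F) :=
  (C ⊓ zeroOn T).map (restrictTo T)

/-- The code `C` has minimum distance (exactly) `d`. -/
def IsMinDist {ι : Type} [Fintype ι] [DecidableEq F] (C : Submodule F (ι → F)) (d : ℕ) : Prop :=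
  (∃ c ∈ C, c ≠ 0 ∧ hammingNorm c = d) ∧ ∀ c ∈ C, c ≠ 0 → d ≤ hammingNorm c

/-- `A_k(C)`: the number of codewords of Hamming weight `k` in `C`. -/
noncomputable def weightCount {ι : Type} [Fintype ι] [DecidableEq F]
    (C : Submodule F (ι → F)) (k : ℕ) : ℕ :=
  Nat.card {c : ι → F // c ∈ C ∧ hammingNorm c = k}

/-- A monomial transformation: permute the coordinates and scale each coordinate. -/
def monomialMap {ι κ : Type} (σ : ι ≃ κ) (u : κ → F) : (ι → F) →ₗ[F] (κ → F) where
  toFun x := fun j => u j * x (σ.symm j)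
  map_add' a b := by
    funext j
    simp [Pi.add_apply, mul_add]
  map_smul' r a := by
    funext j
    simp only [Pi.smul_apply, smul_eq_mul, RingHom.id_apply]
    ring

/-- Monomial equivalence of linear codes. -/
def MonomiallyEquiv {ι κ : Type} (C : Submodule F (ι → F)) (D : Submodule F (κ → F)) : Prop :=
  ∃ (σ : ι ≃ κ) (u : κ → F), (∀ j, u j ≠ 0) ∧ D = C.map (monomialMap σ u)

/-- The syndrome map attached to a parity-check matrix with columns `v i`. -/
def checkMap {m n : ℕ} (v : Fin n → (Fin m → F)) : (Fin n → F) →ₗ[F] (Fin m → F) where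
  toFun x := fun j => ∑ i, x i * v i j
  map_add' a b := by
    funext j
    simp [Pi.add_apply, add_mul, Finset.sum_add_distrib]
  map_smul' r a := by
    funext j
    simp [Pi.smul_apply, Finset.mul_sum, mul_assoc]

/-- `v` lists exactly one nonzero vector from each one-dimensional subspace of `F^m`. -/
def IsHammingMatrix {m n : ℕ} (v : Fin n → (Fin m → F)) : Prop :=
  (∀ i, v i ≠ 0) ∧ ∀ w : Fin m → F, w ≠ 0 → ∃! i : Fin n, ∃ c : F, w = c • v i

/-- The Hamming code attached to a parity-check matrix whose columns are the `v i`. -/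
def hammingCode {m n : ℕ} (v : Fin n → (Fin m → F)) : Submodule F (Fin n → F) :=
  LinearMap.ker (checkMap v)

/-- The Simplex code: the dual of the Hamming code. -/
def simplexCode {m n : ℕ} (v : Fin n → (Fin m → F)) : Submodule F (Fin n → F) :=
  dualCode (hammingCode v)

end Defs

lemma aux_indep {F : Type} [Field F] {m n : ℕ} (v : Fin n → (Fin m → F))
    (hv : IsHammingMatrix v) {i j : Fin n} (hij : i ≠ j) {a b : F}
    (h : a • v i + b • v j = 0) : a = 0 ∧ b = 0 := by
  have ha : a = 0 := by
    by_contra ha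
    apply hij
    refine (hv.2 (v i) (hv.1 i)).unique ⟨1, by simp⟩ ⟨-(a⁻¹ * b), ?_⟩
    have h2 : a⁻¹ • (a • v i + b • v j) = 0 := by rw [h, smul_zero]
    rw [smul_add, smul_smul, smul_smul, inv_mul_cancel₀ ha, one_smul] at h2
    rw [neg_smul]
    exact eq_neg_of_add_eq_zero_left h2
  subst ha
  refine ⟨rfl, ?_⟩
  simp only [zero_smul, zero_add, smul_eq_zero] at h
  exact h.resolve_right (hv.1 j)

lemma aux_mem {F : Type} [Field F] {m n : ℕ} (v : Fin n → (Fin m → F)) (x : Fin n → F) :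
    x ∈ hammingCode v ↔ ∑ i, x i • v i = 0 := by
  rw [hammingCode, LinearMap.mem_ker]
  have : checkMap v x = ∑ i, x i • v i := by
    funext j
    simp [checkMap, Finset.sum_apply]
  rw [this]

lemma aux_norm {F : Type} [Field F] [DecidableEq F] {n : ℕ} (T : Finset (Fin n))
    (x : Fin n → F) (hx : x ∈ zeroOn (F := F) T) :
    hammingNorm (restrictTo T x) = hammingNorm x := by
  unfold hammingNorm
  refine Finset.card_bij (fun i _ => i.1) ?_ ?_ ?_
  · intro a ha
    exact Finset.mem_filter.2 ⟨Finset.mem_univ _, (Finset.mem_filter.1 ha).2⟩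
  · intro a _ b _ h
    exact Subtype.ext h
  · intro b hb
    have hb' : x b ≠ 0 := by simpa using hb
    exact ⟨⟨b, fun hT => hb' (hx b hT)⟩,
      Finset.mem_filter.2 ⟨Finset.mem_univ _, hb'⟩, rfl⟩

lemma aux_lower {F : Type} [Field F] [DecidableEq F] {m n : ℕ} (v : Fin n → (Fin m → F))
    (hv : IsHammingMatrix v) (x : Fin n → F) (hx : x ∈ hammingCode v) (h0 : x ≠ 0) :
    3 ≤ hammingNorm x := by
  by_contra! hlt
  rw [aux_mem] at hx
  have hpos : 0 < hammingNorm x := hammingNorm_pos_iff.2 h0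
  have hs : ∑ i ∈ Finset.univ.filter (fun i => x i ≠ 0), x i • v i = 0 := by
    rw [← hx]
    apply Finset.sum_subset (Finset.filter_subset _ _)
    intro i _ hi
    have : x i = 0 := by simpa using hi
    simp [this]
  have hc : (Finset.univ.filter (fun i => x i ≠ 0)).card = 1 ∨
      (Finset.univ.filter (fun i => x i ≠ 0)).card = 2 := by
    have : (Finset.univ.filter (fun i => x i ≠ 0)).card = hammingNorm x := rfl
    omega
  rcases hc with hc | hc
  · obtain ⟨i, hi⟩ := Finset.card_eq_one.1 hc
    rw [hi, Finset.sum_singleton, smul_eq_zero] at hs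
    have : i ∈ Finset.univ.filter (fun i => x i ≠ 0) := by simp [hi]
    exact hs.elim (by simpa using this) (hv.1 i)
  · obtain ⟨i, j, hij, hi⟩ := Finset.card_eq_two.1 hc
    rw [hi, Finset.sum_pair hij] at hs
    have : i ∈ Finset.univ.filter (fun i => x i ≠ 0) := by simp [hi]
    exact absurd (aux_indep v hv hij hs).1 (by simpa using this)

lemma aux_word {F : Type} [Field F] [DecidableEq F] {m n : ℕ} (v : Fin n → (Fin m → F))
    (T : Finset (Fin n)) {i j k : Fin n} (hi : i ∉ T) (hj : j ∉ T) (hk : k ∉ T)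
    (hij : i ≠ j) (hik : i ≠ k) (hjk : j ≠ k) {a b c : F} (ha : a ≠ 0) (hb : b ≠ 0) (hc : c ≠ 0)
    (h : a • v i + b • v j + c • v k = 0) :
    ∃ c ∈ shortenedCode (hammingCode v) T, c ≠ 0 ∧ hammingNorm c = 3 := by
  let x : Fin n → F := fun l => if l = i then a else if l = j then b else if l = k then c else 0
  have hsupp : Finset.univ.filter (fun l => x l ≠ 0) = {i, j, k} := by
    ext l
    simp only [x, Finset.mem_filter, Finset.mem_univ, true_and, Finset.mem_insert,
      Finset.mem_singleton]
    split_ifs <;> simp_all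
  have hn : hammingNorm x = 3 := by
    change (Finset.univ.filter (fun l => x l ≠ 0)).card = 3
    rw [hsupp, Finset.card_eq_three]
    exact ⟨i, j, k, hij, hik, hjk, rfl⟩
  have hz : x ∈ zeroOn (F := F) T := by
    intro l hl
    have h1 : l ≠ i := fun h => hi (h ▸ hl)
    have h2 : l ≠ j := fun h => hj (h ▸ hl)
    have h3 : l ≠ k := fun h => hk (h ▸ hl)
    simp [x, h1, h2, h3]
  have hm : x ∈ hammingCode v := by
    rw [aux_mem]
    have : ∑ l, x l • v l = ∑ l ∈ ({i, j, k} : Finset (Fin n)), x l • v l := by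
      symm
      apply Finset.sum_subset (Finset.subset_univ _)
      intro l _ hl
      rw [← hsupp] at hl
      have : x l = 0 := by simpa using hl
      simp [this]
    rw [this, Finset.sum_insert (by simp [hij, hik]), Finset.sum_pair hjk, ← add_assoc]
    simpa [x, hij.symm, hik.symm, hjk.symm] using h
  have hn' := (aux_norm T x hz).trans hn
  refine ⟨restrictTo T x, ⟨x, ⟨hm, hz⟩, rfl⟩, ?_, hn'⟩
  intro h0
  rw [h0, hammingNorm_zero] at hn'
  omega

lemma aux_count {F : Type} [Field F] [Fintype F] [DecidableEq F] {m n : ℕ}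
    (v : Fin n → (Fin m → F)) (hv : IsHammingMatrix v) (T : Finset (Fin n))
    (hno : ¬ ∃ c ∈ shortenedCode (hammingCode v) T, c ≠ 0 ∧ hammingNorm c = 3)
    (p : Fin n) (hp : p ∉ T) :
    ((Tᶜ).erase p).card * Fintype.card F ≤ n - 1 := by
  have hne : ∀ s, s ≠ p → ∀ a : F, v s + a • v p ≠ 0 := by
    intro s hs a h
    have := (aux_indep v hv hs (a := 1) (b := a) (by simpa using h)).1
    exact one_ne_zero this
  have hex : ∀ y : Fin n × F, ∃ k : Fin n, y.1 ≠ p →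
      ∃ c : F, v y.1 + y.2 • v p = c • v k := by
    intro y
    by_cases hy : y.1 = p
    · exact ⟨p, fun h => absurd hy h⟩
    · obtain ⟨k, hk, _⟩ := hv.2 _ (hne _ hy y.2)
      exact ⟨k, fun _ => hk⟩
  choose f hf using hex
  have key : (((Tᶜ).erase p) ×ˢ (Finset.univ : Finset F)).card ≤
      ((Finset.univ : Finset (Fin n)).erase p).card := by
    apply Finset.card_le_card_of_injOn f
    · rintro ⟨s, a⟩ hy
      have hy' : s ≠ p ∧ s ∉ T := by simpa [and_comm] using hy
      obtain ⟨c, hc⟩ := hf (s, a) hy'.1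
      simp only [Finset.coe_erase, Finset.coe_univ, Set.mem_sdiff, Set.mem_univ,
        Set.mem_singleton_iff, true_and]
      intro hfp
      rw [hfp] at hc
      refine one_ne_zero (aux_indep v hv hy'.1 (a := (1 : F)) (b := a - c) ?_).1
      rw [sub_smul, one_smul, ← add_sub_assoc, sub_eq_zero]
      exact hc
    · rintro ⟨s, a⟩ hy ⟨s', a'⟩ hy' hff
      have hs : s ≠ p ∧ s ∉ T := by simpa [and_comm] using hy
      have hs' : s' ≠ p ∧ s' ∉ T := by simpa [and_comm] using hy'
      obtain ⟨c, hc⟩ := hf (s, a) hs.1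
      obtain ⟨c', hc'⟩ := hf (s', a') hs'.1
      rw [← hff] at hc'
      simp only at hc hc'
      have hc0 : c ≠ 0 := by
        rintro rfl
        exact hne s hs.1 a (by simpa using hc)
      have hc0' : c' ≠ 0 := by
        rintro rfl
        exact hne s' hs'.1 a' (by simpa using hc')
      have hrel : c' • v s + (-c) • v s' + (c' * a - c * a') • v p = 0 := by
        have e : c' • (v s + a • v p) - c • (v s' + a' • v p) = 0 := by
          rw [hc, hc', smul_smul, smul_smul, mul_comm, sub_self]
        rw [← e]
        module
      by_cases hss : s = s'
      · subst hss
        have := aux_indep v hv hs.1 (a := c' - c) (b := c' * a - c * a') (by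
          rw [← hrel]; module)
        have h1 : c' = c := sub_eq_zero.1 this.1
        have h2 := this.2
        rw [h1, ← mul_sub] at h2
        have h3 : a = a' := sub_eq_zero.1 ((mul_eq_zero.1 h2).resolve_left hc0)
        rw [h3]
      · exfalso
        by_cases h0 : c' * a - c * a' = 0
        · rw [h0, zero_smul, add_zero] at hrel
          exact hc0' (aux_indep v hv hss hrel).1
        · exact hno (aux_word v T hs.2 hs'.2 hp hss hs.1 hs'.1 hc0' (neg_ne_zero.2 hc0) h0 hrel)
  simpa [Finset.card_product, Finset.card_erase_of_mem] using key

/-- If `t < ((q-1)/(q+1))·n` for even `m`, resp. `t < ((q-1)/(q+1))·(n - q²)` for odd `m`,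
then the shortened Hamming code `(H_{(q,m)})_T` has minimum distance exactly `3`. -/
theorem statement13 {F : Type} [Field F] [Fintype F] [DecidableEq F] {m n : ℕ}
    (hm : 3 ≤ m) (hq : n * (Fintype.card F - 1) = Fintype.card F ^ m - 1)
    (v : Fin n → (Fin m → F)) (hv : IsHammingMatrix v) (T : Finset (Fin n))
    (hEven : Even m → T.card * (Fintype.card F + 1) < (Fintype.card F - 1) * n)
    (hOdd : ¬ Even m →
      T.card * (Fintype.card F + 1) < (Fintype.card F - 1) * (n - Fintype.card F ^ 2)) :
    IsMinDist (shortenedCode (hammingCode v) T) 3 := by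
  have hT : T.card * (Fintype.card F + 1) < (Fintype.card F - 1) * n := by
    by_cases h : Even m
    · exact hEven h
    · exact (hOdd h).trans_le (Nat.mul_le_mul_left _ (Nat.sub_le _ _))
  constructor
  · by_contra hno
    have hq2 : 1 < Fintype.card F := Fintype.one_lt_card
    have hcard : (Tᶜ).card + T.card = n := by
      have := Finset.card_compl_add_card T
      simpa using this
    have hpow : Fintype.card F ^ 3 ≤ Fintype.card F ^ m := Nat.pow_le_pow_right (by omega) hm
    have hpos : 0 < (Tᶜ).card := by
      by_contra h0
      have : T.card = n := by omega
      rw [this] at hT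
      obtain ⟨r, hr⟩ : ∃ r, Fintype.card F = r + 1 := ⟨Fintype.card F - 1, by omega⟩
      rw [hr] at hT
      simp only [Nat.add_sub_cancel] at hT
      nlinarith
    obtain ⟨p, hp⟩ := Finset.card_pos.1 hpos
    have hcnt := aux_count v hv T hno p (by simpa using hp)
    rw [Finset.card_erase_of_mem hp] at hcnt
    obtain ⟨r, hr⟩ : ∃ r, Fintype.card F = r + 1 := ⟨Fintype.card F - 1, by omega⟩
    obtain ⟨k, hk⟩ : ∃ k, (Tᶜ).card = k + 1 := ⟨(Tᶜ).card - 1, by omega⟩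
    rw [hk] at hcnt hcard
    generalize T.card = t at *
    rw [hr] at hcnt hT hq hpow hq2
    simp only [Nat.add_sub_cancel] at hcnt hT hq
    have hq' : (r + 1) ^ 3 ≤ n * r + 1 := by omega
    have hcnt' : k * (r + 1) + 1 ≤ n := by omega
    clear hEven hOdd hno hq
    have h1 : t = n - (k + 1) := by omega
    zify at *
    have ht : (t : ℤ) = n - (k + 1) := by linarith
    rw [ht] at hT
    have h2 : ((n : ℤ) - (k + 1)) * (r + 1 + 1) + 1 ≤ r * n := by linarith
    have h3 := mul_le_mul_of_nonneg_right h2 (show (0 : ℤ) ≤ r + 1 by positivity)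
    have h4 := mul_le_mul_of_nonneg_right hcnt' (show (0 : ℤ) ≤ r + 1 + 1 by positivity)
    nlinarith [sq_nonneg (r : ℤ), pow_nonneg (show (0 : ℤ) ≤ r by positivity) 3]
  · rintro _ ⟨x, ⟨hx, hz⟩, rfl⟩ h0
    rw [aux_norm T x hz]
    exact aux_lower v hv x hx (fun h => h0 (by rw [h, map_zero]))
end

section
/- Let m ≥ 3, let R(m−2,m) = R(1,m)^⊥, and let t_1 be any coordinate position. Then: (1) the shortened code R(m−2,m)_{{t_1}} is a [2^m−1, 2^m−m−2, 4] binary code; and (2) its dual (R(m−2,m)_{{t_1}})^⊥ is a [2^m−1, m+1, 2^{m−1}−1] binary code with weight enumerator 1 + (2^m−1)z^{2^{m−1}−1} + (2^m−1)z^{2^{m−1}} + z^{2^m−1}. -/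
open Finset

/-- The first-order Reed-Muller code `R(1,m)`: the span of the constant function `1`
and the coordinate functions on `GF(2)^m`; equivalently, all functions
`x ↦ a₀ + u ⬝ x` with `a₀ ∈ GF(2)`, `u ∈ GF(2)^m`. -/
def RM1 (m : ℕ) : Submodule (ZMod 2) ((Fin m → ZMod 2) → ZMod 2) :=
  Submodule.span (ZMod 2)
    ({fun _ => 1} ∪ Set.range (fun i : Fin m => fun x : Fin m → ZMod 2 => x i))

/-- The Reed-Muller code `R(m-2, m)`, defined as the dual of `R(1,m)`. -/
def RMm2 (m : ℕ) : Submodule (ZMod 2) ((Fin m → ZMod 2) → ZMod 2) :=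
  dualCode (RM1 m)


lemma dualCode_eq_orth {ι : Type} [Fintype ι] [DecidableEq ι] {F : Type} [Field F]
    (C : Submodule F (ι → F)) :
    dualCode C = LinearMap.BilinForm.orthogonal (dotProductBilin F F : LinearMap.BilinForm F (ι → F)) C := by
  ext x
  rw [LinearMap.BilinForm.mem_orthogonal_iff]
  apply forall₂_congr
  intro c _
  simp [dotProduct, mul_comm]

lemma dot_nondeg {ι : Type} [Fintype ι] [DecidableEq ι] {F : Type} [Field F] :
    (dotProductBilin F F : LinearMap.BilinForm F (ι → F)).Nondegenerate := by
  refine ⟨fun x hx => ?_, fun x hx => ?_⟩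
  · ext i
    simpa using hx (Pi.single i 1)
  · ext i
    simpa using hx (Pi.single i 1)

lemma dot_refl {ι : Type} [Fintype ι] [DecidableEq ι] {F : Type} [Field F] :
    LinearMap.BilinForm.IsRefl (dotProductBilin F F : LinearMap.BilinForm F (ι → F)) := by
  intro x y h
  simpa [dotProduct_comm] using h

lemma dual_dual {ι : Type} [Fintype ι] [DecidableEq ι] {F : Type} [Field F]
    (C : Submodule F (ι → F)) : dualCode (dualCode C) = C := by
  rw [dualCode_eq_orth, dualCode_eq_orth]
  exact LinearMap.BilinForm.orthogonal_orthogonal dot_nondeg dot_refl C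

lemma finrank_dual {ι : Type} [Fintype ι] [DecidableEq ι] {F : Type} [Field F]
    (C : Submodule F (ι → F)) :
    Module.finrank F (dualCode C) = Fintype.card ι - Module.finrank F C := by
  rw [dualCode_eq_orth, LinearMap.BilinForm.finrank_orthogonal dot_nondeg,
    Module.finrank_fintype_fun_eq_card]

lemma shortened_dual {ι : Type} [Fintype ι] [DecidableEq ι] {F : Type} [Field F]
    (C : Submodule F (ι → F)) (T : Finset ι) :
    shortenedCode (dualCode C) T = dualCode (puncturedCode C T) := by
  have key : ∀ f : ι → F, (∀ i ∈ T, f i = 0) →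
      ∑ i : {i // i ∉ T}, f i = ∑ i, f i := by
    intro f hf
    rw [← Finset.sum_subtype (p := fun i => i ∉ T) (Tᶜ) (by simp) f]
    apply Finset.sum_subset (Finset.subset_univ _)
    intro i _ hi
    exact hf i (by simpa using hi)
  ext c
  constructor
  · rintro ⟨x, ⟨hx, hx0⟩, rfl⟩
    rintro _ ⟨y, hy, rfl⟩
    have := hx y hy
    rw [← this]
    exact key (fun i => x i * y i) (fun i hi => by simp [hx0 i hi])
  · intro hc
    refine ⟨fun i => if h : i ∉ T then c ⟨i, h⟩ else 0, ⟨?_, ?_⟩, ?_⟩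
    · intro y hy
      refine Eq.trans ?_ (hc _ ⟨y, hy, rfl⟩)
      rw [← key _ (fun i hi => by simp [hi])]
      apply Finset.sum_congr rfl
      rintro ⟨i, hi⟩ _
      simp [hi, restrictTo, LinearMap.funLeft]
    · intro i hi
      simp [hi]
    · ext ⟨i, hi⟩
      simp [hi, restrictTo, LinearMap.funLeft]

/-- parametrization of R(1,m), based at `t`. -/
def phiF (m : ℕ) (t : Fin m → ZMod 2) :
    (ZMod 2 × (Fin m → ZMod 2)) →ₗ[ZMod 2] ((Fin m → ZMod 2) → ZMod 2) where
  toFun p := fun x => p.1 + p.2 ⬝ᵥ (x - t)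
  map_add' a b := by
    funext j
    simp only [Prod.fst_add, Prod.snd_add, add_dotProduct, Pi.add_apply]
    ring
  map_smul' r a := by
    funext j
    simp only [Prod.smul_fst, Prod.smul_snd, smul_dotProduct, Pi.smul_apply, smul_eq_mul,
      RingHom.id_apply]
    ring

lemma phiF_apply (m : ℕ) (t : Fin m → ZMod 2) (p) (x) :
    phiF m t p x = p.1 + p.2 ⬝ᵥ (x - t) := rfl

lemma RM1_eq (m : ℕ) (t : Fin m → ZMod 2) : RM1 m = LinearMap.range (phiF m t) := by
  apply le_antisymm
  · apply Submodule.span_le.2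
    rintro f (rfl | ⟨i, rfl⟩)
    · exact ⟨(1, 0), by ext x; simp [phiF_apply]⟩
    · exact ⟨(t i, Pi.single i 1), by ext x; simp [phiF_apply]⟩
  · rintro _ ⟨⟨a, u⟩, rfl⟩
    have h1 : (fun _ => 1 : (Fin m → ZMod 2) → ZMod 2) ∈ RM1 m :=
      Submodule.subset_span (Or.inl rfl)
    have h2 : ∀ i, (fun x : Fin m → ZMod 2 => x i) ∈ RM1 m := fun i =>
      Submodule.subset_span (Or.inr ⟨i, rfl⟩)
    have : phiF m t (a, u) = a • (fun _ => 1 : (Fin m → ZMod 2) → ZMod 2) +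
        ∑ i, u i • ((fun x : Fin m → ZMod 2 => x i) - t i • (fun _ => 1 : (Fin m → ZMod 2) → ZMod 2)) := by
      ext x
      simp [phiF_apply, dotProduct]
    rw [this]
    exact add_mem (Submodule.smul_mem _ _ h1) (Submodule.sum_mem _ fun i _ =>
      Submodule.smul_mem _ _ (sub_mem (h2 i) (Submodule.smul_mem _ _ h1)))

def phi (m : ℕ) (t : Fin m → ZMod 2) :
    (ZMod 2 × (Fin m → ZMod 2)) →ₗ[ZMod 2]
      ({x : Fin m → ZMod 2 // x ∉ ({t} : Finset (Fin m → ZMod 2))} → ZMod 2) :=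
  (restrictTo {t}).comp (phiF m t)

lemma phi_apply (m : ℕ) (t : Fin m → ZMod 2) (p) (x) :
    phi m t p x = p.1 + p.2 ⬝ᵥ (x.1 - t) := rfl

lemma punct_eq (m : ℕ) (t : Fin m → ZMod 2) :
    puncturedCode (RM1 m) {t} = LinearMap.range (phi m t) := by
  rw [puncturedCode, RM1_eq m t, phi, LinearMap.range_comp]

lemma zmod2_cases (a : ZMod 2) : a = 0 ∨ a = 1 := by
  revert a; decide

lemma card_full (m : ℕ) (hm : 3 ≤ m) (t u : Fin m → ZMod 2) (a : ZMod 2) (hu : u ≠ 0) :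
    #{x : Fin m → ZMod 2 | phiF m t (a, u) x ≠ 0} = 2 ^ (m - 1) := by
  obtain ⟨i, hi⟩ : ∃ i, u i ≠ 0 := by
    by_contra! h
    exact hu (funext h)
  have hi1 : u i = 1 := (zmod2_cases _).resolve_left hi
  have hflip : ∀ x, phiF m t (a, u) (x + Pi.single i 1) = phiF m t (a, u) x + 1 := by
    intro x
    simp only [phiF_apply, dotProduct_sub, dotProduct_add, dotProduct_single, hi1]
    ring
  have hinv : ∀ x : Fin m → ZMod 2, x + Pi.single i 1 + Pi.single i 1 = x := by
    intro x
    funext j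
    simp only [Pi.add_apply]
    rw [add_assoc, CharTwo.add_self_eq_zero, add_zero]
  have heq : #{x : Fin m → ZMod 2 | phiF m t (a, u) x ≠ 0} =
      #{x : Fin m → ZMod 2 | ¬ phiF m t (a, u) x ≠ 0} := by
    refine Finset.card_bij' (fun x _ => x + Pi.single i 1) (fun x _ => x + Pi.single i 1) ?_ ?_
      (fun x _ => hinv x) (fun x _ => hinv x)
    · intro x hx
      simp only [Finset.mem_filter, Finset.mem_univ, true_and, hflip] at hx ⊢
      generalize phiF m t (a, u) x = b at *
      revert b; decide
    · intro x hx
      simp only [Finset.mem_filter, Finset.mem_univ, true_and, hflip] at hx ⊢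
      generalize phiF m t (a, u) x = b at *
      revert b; decide
  have htot := Finset.card_filter_add_card_filter_not (s := (Finset.univ : Finset (Fin m → ZMod 2)))
    (fun x => phiF m t (a, u) x ≠ 0)
  rw [← heq, Finset.card_univ] at htot
  simp only [Fintype.card_pi, ZMod.card, Finset.prod_const, Finset.card_univ, Fintype.card_fin] at htot
  obtain ⟨k, rfl⟩ : ∃ k, m = k + 1 := ⟨m - 1, by omega⟩
  rw [pow_succ] at htot
  simp only [Nat.add_sub_cancel]
  omega

lemma card_I (m : ℕ) (t : Fin m → ZMod 2) :
    Fintype.card {x : Fin m → ZMod 2 // x ∉ ({t} : Finset (Fin m → ZMod 2))} = 2 ^ m - 1 := by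
  rw [Fintype.card_subtype_compl]
  simp

lemma norm_split (m : ℕ) (t : Fin m → ZMod 2) (p) :
    hammingNorm (phi m t p) + (if p.1 ≠ 0 then 1 else 0) =
      #{x : Fin m → ZMod 2 | phiF m t p x ≠ 0} := by
  classical
  have h1 : hammingNorm (phi m t p) =
      #((Finset.univ.filter fun x : Fin m → ZMod 2 => phiF m t p x ≠ 0).erase t) := by
    unfold hammingNorm
    apply Finset.card_bij (fun x _ => x.1)
    · rintro ⟨x, hx⟩ h
      simp at hx
      simpa [hx, phi_apply, phiF_apply] using h
    · intro x _ y _ h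
      exact Subtype.ext h
    · intro x hx
      simp at hx
      exact ⟨⟨x, by simpa using hx.1⟩, by simpa [phi_apply, phiF_apply] using hx.2, rfl⟩
  rw [h1]
  have ht : phiF m t p t = p.1 := by simp [phiF_apply]
  split_ifs with h
  · rw [Finset.card_erase_add_one]
    simpa [ht] using h
  · rw [Finset.erase_eq_of_notMem, add_zero]
    simpa [ht] using h

def wt (m : ℕ) (p : ZMod 2 × (Fin m → ZMod 2)) : ℕ :=
  if p.2 = 0 then (if p.1 = 0 then 0 else 2 ^ m - 1)
  else (if p.1 = 0 then 2 ^ (m - 1) else 2 ^ (m - 1) - 1)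

lemma norm_phi (m : ℕ) (hm : 3 ≤ m) (t : Fin m → ZMod 2) (p) :
    hammingNorm (phi m t p) = wt m p := by
  obtain ⟨a, u⟩ := p
  have h := norm_split m t (a, u)
  unfold wt
  by_cases hu : u = 0
  · subst hu
    rcases zmod2_cases a with rfl | rfl
    · simp [← Prod.zero_eq_mk]
    · simp [phiF_apply] at h ⊢
      omega
  · rw [card_full m hm t u a hu] at h
    rcases zmod2_cases a with rfl | rfl
    · simpa [hu] using h
    · simp [hu] at h ⊢
      omega

lemma pow_facts (m : ℕ) (hm : 3 ≤ m) : 4 ≤ 2 ^ (m - 1) ∧ 2 ^ m = 2 * 2 ^ (m - 1) := by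
  obtain ⟨k, rfl⟩ : ∃ k, m = k + 3 := ⟨m - 3, by omega⟩
  have : 1 ≤ 2 ^ k := Nat.one_le_two_pow
  simp only [Nat.reduceSubDiff, pow_succ]
  omega

lemma wt_pos (m : ℕ) (hm : 3 ≤ m) (p) (hp : p ≠ 0) : 2 ^ (m - 1) - 1 ≤ wt m p := by
  obtain ⟨h1, h2⟩ := pow_facts m hm
  unfold wt
  split_ifs with h h' h'
  · exact absurd (Prod.ext h' h) hp
  all_goals omega

lemma phi_inj (m : ℕ) (hm : 3 ≤ m) (t : Fin m → ZMod 2) : Function.Injective (phi m t) := by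
  rw [← LinearMap.ker_eq_bot, LinearMap.ker_eq_bot']
  intro p hp
  by_contra hne
  have h1 := wt_pos m hm p hne
  rw [← norm_phi m hm t, hp, hammingNorm_zero] at h1
  have := pow_facts m hm
  omega

lemma wc (m : ℕ) (hm : 3 ≤ m) (t : Fin m → ZMod 2) (k : ℕ) :
    weightCount (LinearMap.range (phi m t)) k = Nat.card {p // wt m p = k} := by
  unfold weightCount
  symm
  apply Nat.card_congr
  refine Equiv.ofBijective (fun p => ⟨phi m t p.1, ⟨p.1, rfl⟩, by rw [norm_phi m hm]; exact p.2⟩) ⟨?_, ?_⟩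
  · intro p q h
    exact Subtype.ext (phi_inj m hm t (congrArg Subtype.val h))
  · rintro ⟨_, ⟨p, rfl⟩, h⟩
    exact ⟨⟨p, by rwa [norm_phi m hm] at h⟩, rfl⟩

lemma card_ne (m : ℕ) (hm : 3 ≤ m) (k : ℕ) (a : ZMod 2)
    (h : ∀ p, wt m p = k ↔ p.1 = a ∧ p.2 ≠ 0) : Nat.card {p // wt m p = k} = 2 ^ m - 1 := by
  have : Nat.card {p // wt m p = k} = Nat.card {u : Fin m → ZMod 2 // ¬ u = 0} := by
    apply Nat.card_congr
    exact 
      { toFun := fun p => ⟨p.1.2, ((h _).1 p.2).2⟩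
        invFun := fun u => ⟨(a, u.1), (h _).2 ⟨rfl, u.2⟩⟩
        left_inv := fun p => Subtype.ext (Prod.ext ((h _).1 p.2).1.symm rfl)
        right_inv := fun u => rfl }
  rw [this, Nat.card_eq_fintype_card, Fintype.card_subtype_compl]
  simp

lemma card_one (m : ℕ) (k : ℕ) (q)
    (h : ∀ p, wt m p = k ↔ p = q) : Nat.card {p // wt m p = k} = 1 := by
  simp [h]

lemma min4 (m : ℕ) (hm : 3 ≤ m) (t : Fin m → ZMod 2) :
    IsMinDist (dualCode (LinearMap.range (phi m t))) 4 := by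
  classical
  constructor
  · let e0 : Fin m → ZMod 2 := Pi.single ⟨0, by omega⟩ 1
    let e1 : Fin m → ZMod 2 := Pi.single ⟨1, by omega⟩ 1
    let e2 : Fin m → ZMod 2 := Pi.single ⟨2, by omega⟩ 1
    have ne : ∀ v w : Fin m → ZMod 2, (v ⟨0, by omega⟩ ≠ w ⟨0, by omega⟩ ∨
      v ⟨1, by omega⟩ ≠ w ⟨1, by omega⟩ ∨ v ⟨2, by omega⟩ ≠ w ⟨2, by omega⟩) → v ≠ w := by
      rintro v _ h rfl
      simp at h
    have nt : ∀ v : Fin m → ZMod 2, v ≠ 0 → t + v ∉ ({t} : Finset (Fin m → ZMod 2)) := by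
      intro v hv; simpa using hv
    let x0 : {x : Fin m → ZMod 2 // x ∉ ({t} : Finset (Fin m → ZMod 2))} :=
      ⟨t + e0, nt _ (ne _ _ (by simp [e0]))⟩
    let x1 : {x : Fin m → ZMod 2 // x ∉ ({t} : Finset (Fin m → ZMod 2))} :=
      ⟨t + e1, nt _ (ne _ _ (by simp [e1]))⟩
    let x2 : {x : Fin m → ZMod 2 // x ∉ ({t} : Finset (Fin m → ZMod 2))} :=
      ⟨t + e2, nt _ (ne _ _ (by simp [e2]))⟩
    let x3 : {x : Fin m → ZMod 2 // x ∉ ({t} : Finset (Fin m → ZMod 2))} :=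
      ⟨t + (e0 + e1 + e2), nt _ (ne _ _ (by simp [e0, e1, e2, Pi.single_apply]))⟩
    have h01 : x0 ≠ x1 := by
      simp only [x0, x1, ne_eq, Subtype.mk.injEq, add_right_inj]
      exact ne _ _ (by simp [e0, e1, Pi.single_apply])
    have h02 : x0 ≠ x2 := by
      simp only [x0, x2, ne_eq, Subtype.mk.injEq, add_right_inj]
      exact ne _ _ (by simp [e0, e2, Pi.single_apply])
    have h03 : x0 ≠ x3 := by
      simp only [x0, x3, ne_eq, Subtype.mk.injEq, add_right_inj]
      exact ne _ _ (by simp [e0, e1, e2, Pi.single_apply])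
    have h12 : x1 ≠ x2 := by
      simp only [x1, x2, ne_eq, Subtype.mk.injEq, add_right_inj]
      exact ne _ _ (by simp [e1, e2, Pi.single_apply])
    have h13 : x1 ≠ x3 := by
      simp only [x1, x3, ne_eq, Subtype.mk.injEq, add_right_inj]
      exact ne _ _ (by simp [e0, e1, e2, Pi.single_apply])
    have h23 : x2 ≠ x3 := by
      simp only [x2, x3, ne_eq, Subtype.mk.injEq, add_right_inj]
      exact ne _ _ (by simp [e0, e1, e2, Pi.single_apply])
    let S : Finset {x : Fin m → ZMod 2 // x ∉ ({t} : Finset (Fin m → ZMod 2))} := {x0, x1, x2, x3}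
    have hS : hammingNorm (fun x => if x ∈ S then (1 : ZMod 2) else 0) = 4 := by
      have : hammingNorm (fun x => if x ∈ S then (1 : ZMod 2) else 0) = #S := by
        unfold hammingNorm
        congr 1
        ext x
        simp
      rw [this]
      simp [S, Finset.card_insert_of_notMem, h01, h02, h03, h12, h13, h23]
    refine ⟨fun x => if x ∈ S then 1 else 0, ?_, ?_, hS⟩
    · rintro _ ⟨⟨a, u⟩, rfl⟩
      simp only [ite_mul, one_mul, zero_mul, Finset.sum_ite_mem, Finset.univ_inter]
      rw [show S = {x0, x1, x2, x3} from rfl, Finset.sum_insert (by simp [h01, h02, h03]),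
        Finset.sum_insert (by simp [h12, h13]), Finset.sum_insert (by simp [h23]),
        Finset.sum_singleton]
      simp only [phi_apply, x0, x1, x2, x3, add_sub_cancel_left, dotProduct_add]
      generalize u ⬝ᵥ e0 = b0
      generalize u ⬝ᵥ e1 = b1
      generalize u ⬝ᵥ e2 = b2
      revert a b0 b1 b2; decide
    · intro h0
      rw [h0] at hS
      simp at hS
  · intro c hc h0
    have hpos : hammingNorm c ≠ 0 := by simpa using h0
    have hsum : ∀ p, ∑ x ∈ Finset.univ.filter (fun x => c x ≠ 0), phi m t p x = 0 := by
      intro p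
      refine Eq.trans ?_ (hc _ ⟨p, rfl⟩)
      rw [Finset.sum_filter]
      apply Finset.sum_congr rfl
      intro x _
      rcases zmod2_cases (c x) with h | h <;> simp [h]
    have heven : Even (hammingNorm c) := by
      have := hsum (1, 0)
      simp only [phi_apply, zero_dotProduct, add_zero, Finset.sum_const, nsmul_eq_mul, mul_one] at this
      exact (ZMod.natCast_eq_zero_iff_even).1 this
    have h2 : hammingNorm c ≠ 2 := by
      intro h
      obtain ⟨x, y, hxy, hs⟩ := Finset.card_eq_two.1 h
      apply hxy
      apply Subtype.ext
      funext i
      have := hsum (0, Pi.single i 1)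
      rw [hs, Finset.sum_pair hxy] at this
      simp only [phi_apply, single_dotProduct, Pi.sub_apply, one_mul, zero_add] at this
      generalize x.1 i = a at *
      generalize y.1 i = b at *
      generalize t i = d at *
      clear * - this
      revert a b d; decide
    obtain ⟨k, hk⟩ := heven
    omega

/-- The shortened Reed-Muller code `R(m-2,m)_{{t₁}}` is a `[2^m-1, 2^m-m-2, 4]` binary code,
and its dual is a `[2^m-1, m+1, 2^{m-1}-1]` binary code with weight enumerator
`1 + (2^m-1)z^{2^{m-1}-1} + (2^m-1)z^{2^{m-1}} + z^{2^m-1}`. -/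
theorem statement15 {m : ℕ} (hm : 3 ≤ m) (t1 : Fin m → ZMod 2) :
    Nat.card {x : Fin m → ZMod 2 // x ∉ ({t1} : Finset (Fin m → ZMod 2))} = 2 ^ m - 1 ∧
    Module.finrank (ZMod 2) ↥(shortenedCode (RMm2 m) {t1}) = 2 ^ m - m - 2 ∧
    IsMinDist (shortenedCode (RMm2 m) {t1}) 4 ∧
    Module.finrank (ZMod 2) ↥(dualCode (shortenedCode (RMm2 m) {t1})) = m + 1 ∧
    IsMinDist (dualCode (shortenedCode (RMm2 m) {t1})) (2 ^ (m - 1) - 1) ∧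
    weightCount (dualCode (shortenedCode (RMm2 m) {t1})) 0 = 1 ∧
    weightCount (dualCode (shortenedCode (RMm2 m) {t1})) (2 ^ (m - 1) - 1) = 2 ^ m - 1 ∧
    weightCount (dualCode (shortenedCode (RMm2 m) {t1})) (2 ^ (m - 1)) = 2 ^ m - 1 ∧
    weightCount (dualCode (shortenedCode (RMm2 m) {t1})) (2 ^ m - 1) = 1 ∧
    ∀ k : ℕ, k ≠ 0 → k ≠ 2 ^ (m - 1) - 1 → k ≠ 2 ^ (m - 1) → k ≠ 2 ^ m - 1 →
      weightCount (dualCode (shortenedCode (RMm2 m) {t1})) k = 0 := by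
  have hsh : shortenedCode (RMm2 m) {t1} = dualCode (LinearMap.range (phi m t1)) := by
    rw [RMm2, shortened_dual, punct_eq]
  have hrk : Module.finrank (ZMod 2) (LinearMap.range (phi m t1)) = m + 1 := by
    rw [LinearMap.finrank_range_of_inj (phi_inj m hm t1)]
    simp [add_comm]
  obtain ⟨hp1, hp2⟩ := pow_facts m hm
  rw [hsh, dual_dual]
  simp only [wc m hm]
  have hz : ∀ a : ZMod 2, ¬ a = 0 ↔ a = 1 := by decide
  refine ⟨?_, ?_, min4 m hm t1, hrk, ⟨?_, ?_⟩, ?_, ?_, ?_, ?_, ?_⟩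
  · rw [Nat.card_eq_fintype_card, card_I]
  · rw [finrank_dual, hrk, card_I]
    omega
  · have hw : wt m (1, Pi.single ⟨0, by omega⟩ 1) = 2 ^ (m - 1) - 1 := by
      simp [wt]
    refine ⟨_, ⟨(1, Pi.single ⟨0, by omega⟩ 1), rfl⟩, ?_, ?_⟩
    · rw [← hammingNorm_ne_zero_iff, norm_phi m hm, hw]
      omega
    · rw [norm_phi m hm, hw]
  · rintro _ ⟨p, rfl⟩ hne
    rw [norm_phi m hm]
    apply wt_pos m hm
    rintro rfl
    simp at hne
  · apply card_one m _ (0, 0)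
    rintro ⟨a, u⟩
    simp only [wt, Prod.mk.injEq]
    split_ifs with h1 h2 h2 <;> simp [h1, h2] <;> omega
  · apply card_ne m hm _ 1
    rintro ⟨a, u⟩
    rw [← hz]
    simp only [wt]
    split_ifs with h1 h2 h2 <;> simp [h1, h2] <;> omega
  · apply card_ne m hm _ 0
    rintro ⟨a, u⟩
    simp only [wt]
    split_ifs with h1 h2 h2 <;> simp [h1, h2] <;> omega
  · apply card_one m _ (1, 0)
    rintro ⟨a, u⟩
    simp only [wt, Prod.mk.injEq]
    rw [← hz]
    split_ifs with h1 h2 h2 <;> simp [h1, h2] <;> omega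
  · intro k k0 k1 k2 k3
    have : IsEmpty {p // wt m p = k} := by
      constructor
      rintro ⟨p, hp⟩
      simp only [wt] at hp
      split_ifs at hp <;> omega
    exact Nat.card_of_isEmpty
end
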